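/- arXiv:math/0508409 — 2 statements merged into one kernel-verified Lean document; each statement's English description precedes it below -/
import Mathlib

section
/- Let p ≥ 5 be a prime and m ≥ 2 an integer with p ∤ m. Then ((m/p)·q^{2Σ_{j∈R_p(m)}(p−⟨jm⟩_p)}·(q^{2m};q^{2m})_{(p−1)/2}/(q^2;q^2)_{(p−1)/2} − 1)/[p]_q ≡ 2 Σ_{j=1}^{(p−1)/2} ⌊jm/p⌋·q^{2jm}/[2jm]_q + Q_p(2,q) − Q_p(2,q^m)/[m]_q − |R_p(m)|·(1−q) (mod [p]_q). -/
open Polynomial Finset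

/-- The indeterminate `q` as an element of the rational function field `ℚ(q)`. -/
noncomputable def q : RatFunc ℚ := algebraMap (Polynomial ℚ) (RatFunc ℚ) Polynomial.X

/-- The `q`-integer `[n]_a = 1 + a + ⋯ + a^(n-1)` with base `a ∈ ℚ(q)`. -/
noncomputable def qn (a : RatFunc ℚ) (n : ℕ) : RatFunc ℚ := ∑ i ∈ Finset.range n, a ^ i

/-- The `q`-Pochhammer symbol `(x; a)_n = ∏_{i=0}^{n-1} (1 - x a^i)`. -/
noncomputable def qpoch (x a : RatFunc ℚ) (n : ℕ) : RatFunc ℚ :=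
  ∏ i ∈ Finset.range n, (1 - x * a ^ i)

/-- The Gaussian binomial coefficient `[n choose k]_a = (a;a)_n / ((a;a)_k (a;a)_{n-k})`. -/
noncomputable def qbinom (a : RatFunc ℚ) (n k : ℕ) : RatFunc ℚ :=
  qpoch a a n / (qpoch a a k * qpoch a a (n - k))

/-- The polynomial `q`-integer `[n]_a = 1 + a + ⋯ + a^(n-1)` with base `a ∈ ℚ[q]`. -/
noncomputable def pqn (a : Polynomial ℚ) (n : ℕ) : Polynomial ℚ := ∑ i ∈ Finset.range n, a ^ i

/-- `A ≡ B (mod g)`: the rational function `(A - B)/g`, written in lowest terms,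
has denominator coprime to `g`. -/
def qCong (g : Polynomial ℚ) (A B : RatFunc ℚ) : Prop :=
  IsCoprime (((A - B) / algebraMap (Polynomial ℚ) (RatFunc ℚ) g).denom) g

/-- The `q`-Fermat quotient `Q_p(m, a) = ((a^m; a^m)_{p-1} / (a; a)_{p-1} - 1) / [p]_a`. -/
noncomputable def QF (p m : ℕ) (a : RatFunc ℚ) : RatFunc ℚ :=
  (qpoch (a ^ m) (a ^ m) (p - 1) / qpoch a a (p - 1) - 1) / qn a p

/-- `⟨x⟩_p`: the least non-negative residue of the integer `x` modulo `p`. -/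
def res (p : ℕ) (x : ℤ) : ℕ := (x % (p : ℤ)).toNat

/-- `R_p(m) = {j : 1 ≤ j < p/2, ⟨jm⟩_p > p/2}` (for odd `p`, `1 ≤ j < p/2` means
`1 ≤ j ≤ (p-1)/2`, and `⟨jm⟩_p > p/2` means `2⟨jm⟩_p > p`). -/
def Rset (p : ℕ) (m : ℤ) : Finset ℕ :=
  (Finset.Icc 1 ((p - 1) / 2)).filter fun j => p < 2 * res p ((j : ℤ) * m)


section Approximation

variable {K : Type*} [Field K]

/-- `u = 1 + P x` up to `P² O`, with `x` in the subring `O`. -/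
def ApproxOne (O : Subring K) (P u x : K) : Prop :=
  x ∈ O ∧ ∃ c ∈ O, u = 1 + P * x + P ^ 2 * c

/-- `x` and `y` agree modulo `P O`. -/
def CongrMod (O : Subring K) (P x y : K) : Prop :=
  ∃ c ∈ O, x - y = P * c

/-- `P` plays the role of the `q`-integer `[p]_q` in a subring `O` containing `q` in which
`1 - q ^ k` is invertible for every `k` prime to `p`. -/
structure IsQPrime (O : Subring K) (q P : K) (p : ℕ) : Prop where
  mem : q ∈ O
  prime_mem : P ∈ O
  prime_ne_zero : P ≠ 0
  one_sub_mul : (1 - q) * P = 1 - q ^ p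
  one_sub_pow_ne_zero : ∀ k, ¬ p ∣ k → 1 - q ^ k ≠ 0
  inv_mem : ∀ k, ¬ p ∣ k → (1 - q ^ k)⁻¹ ∈ O

variable {O : Subring K} {q P u v x y : K} {p : ℕ}

theorem ApproxOne.one : ApproxOne O P 1 0 :=
  ⟨O.zero_mem, 0, O.zero_mem, by ring⟩

theorem ApproxOne.mul (hP : P ∈ O) (hu : ApproxOne O P u x) (hv : ApproxOne O P v y) :
    ApproxOne O P (u * v) (x + y) := by
  obtain ⟨hx, c, hc, rfl⟩ := hu
  obtain ⟨hy, d, hd, rfl⟩ := hv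
  exact ⟨O.add_mem hx hy, x * y + c + d + P * (x * d + c * y) + P ^ 2 * (c * d), by aesop, by ring⟩

theorem ApproxOne.prod {ι : Type*} (hP : P ∈ O) (s : Finset ι) {f g : ι → K}
    (h : ∀ i ∈ s, ApproxOne O P (f i) (g i)) :
    ApproxOne O P (∏ i ∈ s, f i) (∑ i ∈ s, g i) := by
  classical
  induction s using Finset.induction_on with
  | empty => simpa using ApproxOne.one
  | insert a s ha ih =>
    rw [Finset.prod_insert ha, Finset.sum_insert ha]
    exact (h a (Finset.mem_insert_self a s)).mul hP
      (ih fun i hi => h i (Finset.mem_insert_of_mem hi))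

theorem ApproxOne.congrMod (hP : P ≠ 0) (h : ApproxOne O P u x) :
    CongrMod O P ((u - 1) / P) x := by
  obtain ⟨-, c, hc, rfl⟩ := h
  exact ⟨c, hc, by field_simp; ring⟩

theorem IsQPrime.exists_one_sub_pow_mul (h : IsQPrime O q P p) (k : ℕ) :
    ∃ d ∈ O, 1 - q ^ (p * k) = P * ((1 - q) * k + P * d) := by
  induction k with
  | zero => exact ⟨0, O.zero_mem, by simp⟩
  | succ k ih =>
    obtain ⟨d, hd, hk⟩ := ih
    have hq := h.mem
    have hP := h.prime_mem
    refine ⟨d - (1 - q) * ((1 - q) * k + P * d), ?_, ?_⟩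
    · aesop
    · push_cast
      rw [mul_add, pow_add, mul_one]
      linear_combination (1 - (1 - q) * P) * hk - q ^ (p * k) * h.one_sub_mul

/-- The contribution of an index whose residue `s` lies below `p / 2`. -/
theorem IsQPrime.approxOne_of_eq_add (h : IsQPrime O q P p) {E f s : ℕ} (hE : ¬ p ∣ 2 * E)
    (hs : ¬ p ∣ 2 * s) (hEs : E = p * f + s) :
    ApproxOne O P ((1 - q ^ (2 * E)) / (1 - q ^ (2 * s)))
      ((1 - q) * (2 * f * q ^ (2 * E) / (1 - q ^ (2 * E)) - 1 / (1 - q ^ (2 * s)) +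
        1 / (1 - q ^ (2 * E)))) := by
  obtain ⟨d, hd, hW⟩ := h.exists_one_sub_pow_mul (2 * f)
  have hq := h.mem
  have hP := h.prime_mem
  have hZW : q ^ (2 * E) = q ^ (2 * s) * q ^ (p * (2 * f)) := by
    rw [hEs, ← pow_add]; ring_nf
  have hb := h.inv_mem _ hE
  have ha := h.inv_mem _ hs
  have hb1 := mul_inv_cancel₀ (h.one_sub_pow_ne_zero _ hE)
  have ha1 := mul_inv_cancel₀ (h.one_sub_pow_ne_zero _ hs)
  have hV : q ^ (2 * E) ∈ O := pow_mem hq _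
  have hZ : q ^ (2 * s) ∈ O := pow_mem hq _
  simp only [div_eq_mul_inv, one_mul]
  generalize q ^ (2 * E) = V at *
  generalize q ^ (2 * s) = Z at *
  generalize q ^ (p * (2 * f)) = W at *
  generalize (1 - V)⁻¹ = b at *
  generalize (1 - Z)⁻¹ = a at *
  subst hZW
  push_cast at hW
  have hab : a - b = a * b * Z * (1 - W) := by linear_combination b * ha1 - a * hb1
  rw [hW] at hab
  refine ⟨?_, a * Z * d + (1 - q) * (2 * f + 1) * (a * b * Z * ((1 - q) * (2 * f) + P * d)), ?_, ?_⟩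
  · have : (2 : K) ∈ O := ofNat_mem O 2
    aesop
  · have : (2 : K) ∈ O := ofNat_mem O 2
    aesop
  · linear_combination ha1 + a * Z * hW + P * (1 - q) * (2 * f + 1) * hab
      - 2 * P * f * (1 - q) * (ha1 - hb1)

/-- The contribution of an index whose residue `p - s` lies above `p / 2`. -/
theorem IsQPrime.approxOne_of_add_eq (h : IsQPrime O q P p) {E f s : ℕ} (hE : ¬ p ∣ 2 * E)
    (hs : ¬ p ∣ 2 * s) (hEs : E + s = p * (f + 1)) :
    ApproxOne O P (-q ^ (2 * s) * ((1 - q ^ (2 * E)) / (1 - q ^ (2 * s))))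
      ((1 - q) * (2 * f * q ^ (2 * E) / (1 - q ^ (2 * E)) - 1 / (1 - q ^ (2 * s)) +
        1 / (1 - q ^ (2 * E)) - 1)) := by
  obtain ⟨d, hd, hW⟩ := h.exists_one_sub_pow_mul (2 * (f + 1))
  have hq := h.mem
  have hP := h.prime_mem
  have hZW : q ^ (p * (2 * (f + 1))) = q ^ (2 * s) * q ^ (2 * E) := by
    rw [mul_left_comm, ← hEs, ← pow_add]; ring_nf
  rw [hZW] at hW
  have hb := h.inv_mem _ hE
  have ha := h.inv_mem _ hs
  have hb1 := mul_inv_cancel₀ (h.one_sub_pow_ne_zero _ hE)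
  have ha1 := mul_inv_cancel₀ (h.one_sub_pow_ne_zero _ hs)
  have hV : q ^ (2 * E) ∈ O := pow_mem hq _
  have hZ : q ^ (2 * s) ∈ O := pow_mem hq _
  simp only [div_eq_mul_inv, one_mul]
  generalize q ^ (2 * E) = V at *
  generalize q ^ (2 * s) = Z at *
  generalize (1 - V)⁻¹ = b at *
  generalize (1 - Z)⁻¹ = a at *
  push_cast at hW
  have hab : a + b - 1 = a * b * (1 - Z * V) := by
    linear_combination (-a) * hb1 + (-b) * ha1 + (1 - Z) * a * hb1 + ha1
  rw [hW] at hab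
  refine ⟨?_, -(a * d) - (1 - q) * (2 * f + 1) * (a * b * ((1 - q) * (2 * (f + 1)) + P * d)),
    ?_, ?_⟩
  · have : (2 : K) ∈ O := ofNat_mem O 2
    aesop
  · have : (2 : K) ∈ O := ofNat_mem O 2
    aesop
  · linear_combination ha1 - a * hW - P * (1 - q) * (2 * f + 1) * hab
      + 2 * P * f * (1 - q) * hb1

/-- The product defining the `q`-Fermat quotient with `m = 2`, folded around `p / 2`. -/
theorem prod_range_two_mul_fold (n : ℕ) (a : K) :
    (∏ i ∈ Finset.range (2 * n), (1 - a ^ (2 * (i + 1)))) /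
        ∏ i ∈ Finset.range (2 * n), (1 - a ^ (i + 1)) =
      (∏ k ∈ Finset.range n, (1 - a ^ (2 * (k + 1)))) /
        (∏ k ∈ Finset.range n, (1 - a ^ (2 * (k + 1)))) *
      ∏ k ∈ Finset.range n,
        (1 - a ^ (2 * (2 * n - k))) / (1 - a ^ (2 * n - 1 - 2 * k)) := by
  have hnum : ∏ i ∈ Finset.range (2 * n), (1 - a ^ (2 * (i + 1))) =
      (∏ k ∈ Finset.range n, (1 - a ^ (2 * (k + 1)))) *
        ∏ k ∈ Finset.range n, (1 - a ^ (2 * (2 * n - k))) := by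
    rw [two_mul, Finset.prod_range_add,
      ← Finset.prod_range_reflect (fun i => 1 - a ^ (2 * (n + i + 1)))]
    congr 1
    refine Finset.prod_congr rfl fun k hk => ?_
    rw [Finset.mem_range] at hk
    congr 3
    lia
  have hden : ∏ i ∈ Finset.range (2 * n), (1 - a ^ (i + 1)) =
      (∏ k ∈ Finset.range n, (1 - a ^ (2 * (k + 1)))) *
        ∏ k ∈ Finset.range n, (1 - a ^ (2 * n - 1 - 2 * k)) := by
    have : ∏ k ∈ Finset.range n, (1 - a ^ (2 * n - 1 - 2 * k)) =
        ∏ k ∈ Finset.range n, (1 - a ^ (2 * k + 1)) := by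
      rw [← Finset.prod_range_reflect]
      refine Finset.prod_congr rfl fun k hk => ?_
      rw [Finset.mem_range] at hk
      congr 2
      lia
    rw [this]
    clear this hnum
    induction n with
    | zero => simp
    | succ n ih =>
      rw [mul_add_one, Finset.prod_range_succ, Finset.prod_range_succ, ih, Finset.prod_range_succ,
        Finset.prod_range_succ]
      ring
  rw [hnum, hden, mul_div_mul_comm, Finset.prod_div_distrib]

/-- The `q`-Fermat quotient product with `m = 2` to first order. -/
theorem IsQPrime.approxOne_fermat (h : IsQPrime O q P p) {n : ℕ} (hp : p.Prime)
    (hn : p = 2 * n + 1) :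
    ApproxOne O P ((∏ i ∈ Finset.range (2 * n), (1 - q ^ (2 * (i + 1)))) /
        ∏ i ∈ Finset.range (2 * n), (1 - q ^ (i + 1)))
      (∑ k ∈ Finset.range n, -((1 - q) / (1 - q ^ (2 * (k + 1))))) := by
  rw [prod_range_two_mul_fold, div_self, one_mul]
  · refine ApproxOne.prod h.prime_mem _ fun k hk => ?_
    rw [Finset.mem_range] at hk
    have hk1 : ¬ p ∣ 2 * (k + 1) := fun hd => by
      have := Nat.le_of_dvd (by lia) hd
      lia
    have hk2 : ¬ p ∣ 2 * n - 1 - 2 * k := fun hd => by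
      have := Nat.le_of_dvd (by lia) hd
      lia
    have hq := h.mem
    have hP := h.prime_mem
    have hb := h.inv_mem _ hk1
    have ha := h.inv_mem _ hk2
    have hb1 := mul_inv_cancel₀ (h.one_sub_pow_ne_zero _ hk1)
    have ha1 := mul_inv_cancel₀ (h.one_sub_pow_ne_zero _ hk2)
    have hY : q ^ (2 * n - 1 - 2 * k) * q ^ (2 * (k + 1)) = q ^ p := by
      rw [← pow_add]; congr 1; lia
    have hU : q ^ (2 * (2 * n - k)) = q ^ (2 * n - 1 - 2 * k) * q ^ p := by
      rw [← pow_add]; congr 1; lia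
    have h1 := h.one_sub_mul
    rw [hU]
    simp only [div_eq_mul_inv]
    generalize q ^ (2 * n - 1 - 2 * k) = Y at *
    generalize q ^ (2 * (k + 1)) = Z at *
    generalize q ^ p = W at *
    generalize (1 - Y)⁻¹ = a at *
    generalize (1 - Z)⁻¹ = b at *
    subst hY
    refine ⟨by aesop, (1 - q) * (a * b * (1 - q)), by aesop, ?_⟩
    have hab : a - 1 + b = a * b * (1 - Y * Z) := by
      linear_combination (-a) * hb1 + (-b) * ha1 + (1 - Y) * a * hb1 + ha1
    linear_combination ha1 - (1 - q) * P * ha1 - a * Y * h1 + (1 - q) * P * hab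
      - (1 - q) * P * a * b * h1
  · refine Finset.prod_ne_zero_iff.2 fun k hk => h.one_sub_pow_ne_zero _ fun hd => ?_
    rw [Finset.mem_range] at hk
    have := Nat.le_of_dvd (by lia) hd
    lia

end Approximation

section RationalFunctions

/-- Rational functions whose reduced denominator is coprime to `g`. -/
noncomputable def coprimeDenom (g : Polynomial ℚ) : Subring (RatFunc ℚ) where
  carrier := {x | IsCoprime x.denom g}
  mul_mem' {a b} ha hb :=
    (IsCoprime.mul_left ha hb).of_isCoprime_of_dvd_left (RatFunc.denom_mul_dvd a b)
  one_mem' := by simpa using isCoprime_one_left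
  add_mem' {a b} ha hb :=
    (IsCoprime.mul_left ha hb).of_isCoprime_of_dvd_left (RatFunc.denom_add_dvd a b)
  zero_mem' := by simpa using isCoprime_one_left
  neg_mem' {a} ha := by
    have h : (-a).denom ∣ a.denom := by
      rw [RatFunc.denom_dvd (RatFunc.denom_ne_zero a)]
      exact ⟨-a.num, by rw [map_neg, neg_div, RatFunc.num_div_denom]⟩
    exact IsCoprime.of_isCoprime_of_dvd_left ha h

theorem algebraMap_mem_coprimeDenom (g f : Polynomial ℚ) :
    algebraMap (Polynomial ℚ) (RatFunc ℚ) f ∈ coprimeDenom g := by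
  change IsCoprime _ _
  simpa using isCoprime_one_left

theorem inv_algebraMap_mem_coprimeDenom {g f : Polynomial ℚ} (h : IsCoprime f g) :
    (algebraMap (Polynomial ℚ) (RatFunc ℚ) f)⁻¹ ∈ coprimeDenom g := by
  have := RatFunc.denom_div_dvd (K := ℚ) 1 f
  rw [map_one, one_div] at this
  exact h.of_isCoprime_of_dvd_left this

theorem qCong_of_congrMod {g : Polynomial ℚ} {A B : RatFunc ℚ} (hg : g ≠ 0)
    (h : CongrMod (coprimeDenom g) (algebraMap _ _ g) A B) : qCong g A B := by
  obtain ⟨c, hc, hAB⟩ := h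
  have hg' : algebraMap (Polynomial ℚ) (RatFunc ℚ) g ≠ 0 := RatFunc.algebraMap_ne_zero hg
  rw [qCong, hAB, mul_div_cancel_left₀ _ hg']
  exact hc

theorem one_sub_q_pow (k : ℕ) :
    1 - q ^ k = algebraMap (Polynomial ℚ) (RatFunc ℚ) (1 - Polynomial.X ^ k) := by
  simp [q]

theorem one_sub_q_pow_ne_zero {k : ℕ} (hk : k ≠ 0) : 1 - q ^ k ≠ 0 := by
  rw [one_sub_q_pow]
  refine RatFunc.algebraMap_ne_zero ?_
  rw [← neg_ne_zero, neg_sub]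
  exact Polynomial.X_pow_sub_C_ne_zero (Nat.pos_of_ne_zero hk) 1

theorem one_sub_mul_qn (a : RatFunc ℚ) (n : ℕ) : (1 - a) * qn a n = 1 - a ^ n :=
  mul_neg_geom_sum a n

theorem qn_q_eq_algebraMap (n : ℕ) :
    qn q n = algebraMap (Polynomial ℚ) (RatFunc ℚ) (pqn Polynomial.X n) := by
  simp [qn, pqn, q]

theorem qn_ne_zero {m n : ℕ} (hm : m ≠ 0) (hn : n ≠ 0) : qn (q ^ m) n ≠ 0 := by
  intro h
  have := one_sub_mul_qn (q ^ m) n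
  rw [h, mul_zero, ← pow_mul] at this
  exact one_sub_q_pow_ne_zero (mul_ne_zero hm hn) this.symm

theorem qpoch_self (a : RatFunc ℚ) (n : ℕ) :
    qpoch a a n = ∏ i ∈ Finset.range n, (1 - a ^ (i + 1)) := by
  simp only [qpoch, pow_succ']

theorem isCoprime_one_sub_X_pow_pqn {p : ℕ} (hp : p.Prime) {k : ℕ} (hk : ¬ p ∣ k) :
    IsCoprime (1 - Polynomial.X ^ k : Polynomial ℚ) (pqn Polynomial.X p) := by
  have h1 : IsCoprime (1 - Polynomial.X : Polynomial ℚ) (pqn Polynomial.X p) := by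
    rw [← IsCoprime.neg_left_iff, neg_sub, ← Polynomial.C_1,
      (Polynomial.irreducible_X_sub_C (1 : ℚ)).coprime_iff_not_dvd, Polynomial.dvd_iff_isRoot]
    simp [pqn, Polynomial.eval_finsetSum, hp.ne_zero]
  obtain ⟨l, -, hl⟩ := Nat.exists_mul_mod_eq_one_of_coprime
    ((hp.coprime_iff_not_dvd.2 hk).symm) hp.one_lt
  have hkl : k * l = p * (k * l / p) + 1 := by
    conv_lhs => rw [← Nat.div_add_mod (k * l) p, hl]
  have hdvd : (1 - Polynomial.X ^ k : Polynomial ℚ) ∣ 1 - Polynomial.X ^ (k * l) := by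
    rw [pow_mul]
    exact one_sub_dvd_one_sub_pow _ _
  refine IsCoprime.of_isCoprime_of_dvd_left ?_ hdvd
  have hP : (pqn Polynomial.X p : Polynomial ℚ) ∣ 1 - Polynomial.X ^ (p * (k * l / p)) := by
    rw [pow_mul]
    refine dvd_trans ?_ (one_sub_dvd_one_sub_pow _ _)
    exact ⟨1 - Polynomial.X, by rw [pqn, geom_sum_mul_neg]⟩
  obtain ⟨c, hc⟩ := hP
  rw [hkl]
  have : (1 - Polynomial.X ^ (p * (k * l / p) + 1) : Polynomial ℚ) =
      1 - Polynomial.X + pqn Polynomial.X p * (Polynomial.X * c) := by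
    rw [pow_succ]
    linear_combination Polynomial.X * hc
  rw [this]
  exact h1.add_mul_left_left _

theorem isQPrime_qn_q {p : ℕ} (hp : p.Prime) :
    IsQPrime (coprimeDenom (pqn Polynomial.X p)) q (qn q p) p where
  mem := algebraMap_mem_coprimeDenom _ _
  prime_mem := by rw [qn_q_eq_algebraMap]; exact algebraMap_mem_coprimeDenom _ _
  prime_ne_zero := by simpa using qn_ne_zero one_ne_zero hp.ne_zero
  one_sub_mul := one_sub_mul_qn q p
  one_sub_pow_ne_zero k hk := one_sub_q_pow_ne_zero fun h => hk (h ▸ dvd_zero p)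
  inv_mem k hk := by
    rw [one_sub_q_pow]
    exact inv_algebraMap_mem_coprimeDenom (isCoprime_one_sub_X_pow_pqn hp hk)

theorem qn_pow_mem {g : Polynomial ℚ} (m n : ℕ) : qn (q ^ m) n ∈ coprimeDenom g :=
  Subring.sum_mem _ fun _ _ => pow_mem (pow_mem (algebraMap_mem_coprimeDenom _ _) _) _

theorem isQPrime_qn_q_pow {p m : ℕ} (hp : p.Prime) (hm : ¬ p ∣ m) :
    IsQPrime (coprimeDenom (pqn Polynomial.X p)) (q ^ m) (qn (q ^ m) p) p where
  mem := pow_mem (isQPrime_qn_q hp).mem m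
  prime_mem := qn_pow_mem m p
  prime_ne_zero := qn_ne_zero (fun h => hm (h ▸ dvd_zero p)) hp.ne_zero
  one_sub_mul := one_sub_mul_qn (q ^ m) p
  one_sub_pow_ne_zero k hk := by
    rw [← pow_mul]
    exact (isQPrime_qn_q hp).one_sub_pow_ne_zero _ (hp.not_dvd_mul hm hk)
  inv_mem k hk := by
    rw [← pow_mul]
    exact (isQPrime_qn_q hp).inv_mem _ (hp.not_dvd_mul hm hk)

/-- `[p]_{q ^ m}` is a multiple of `[p]_q` when `p ∤ m`. -/
theorem exists_qn_q_pow_eq_mul {p m : ℕ} (hp : p.Prime) (hm : ¬ p ∣ m) :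
    ∃ c ∈ coprimeDenom (pqn Polynomial.X p), qn (q ^ m) p = qn q p * c := by
  have h := isQPrime_qn_q hp
  obtain ⟨d, hd, hdm⟩ := h.exists_one_sub_pow_mul m
  have hq := h.mem
  have hP := h.prime_mem
  have hi := h.inv_mem m hm
  refine ⟨((1 - q) * m + qn q p * d) * (1 - q ^ m)⁻¹, by aesop, ?_⟩
  have h1 := one_sub_mul_qn (q ^ m) p
  rw [← pow_mul, mul_comm m p, hdm] at h1
  rw [← mul_assoc, ← h1]
  field_simp [h.one_sub_pow_ne_zero m hm]

theorem qFermat_two_congrMod {p m n : ℕ} (hp : p.Prime) (hm : ¬ p ∣ m) (hn : p = 2 * n + 1) :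
    CongrMod (coprimeDenom (pqn Polynomial.X p)) (qn q p) (QF p 2 (q ^ m) / qn q m)
      (∑ j ∈ Finset.Icc 1 n, -((1 - q) / (1 - q ^ (2 * (j * m))))) := by
  have h := isQPrime_qn_q_pow hp hm
  obtain ⟨c, hc, hcQ⟩ := (h.approxOne_fermat hp hn).congrMod h.prime_ne_zero
  obtain ⟨e, he, hQ⟩ := exists_qn_q_pow_eq_mul hp hm
  have hq := isQPrime_qn_q hp
  have hqm : qn q m = (1 - q ^ m) / (1 - q) := by
    rw [← one_sub_mul_qn, mul_div_cancel_left₀]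
    simpa using hq.one_sub_pow_ne_zero 1 hp.not_dvd_one
  have hne := hq.one_sub_pow_ne_zero m hm
  have hinv := hq.inv_mem m hm
  have hqO := hq.mem
  refine ⟨(1 - q) * (1 - q ^ m)⁻¹ * (c * e), by aesop, ?_⟩
  have hQF : QF p 2 (q ^ m) = ((∏ i ∈ Finset.range (2 * n), (1 - (q ^ m) ^ (2 * (i + 1)))) /
      (∏ i ∈ Finset.range (2 * n), (1 - (q ^ m) ^ (i + 1))) - 1) / qn (q ^ m) p := by
    rw [QF, qpoch_self, qpoch_self, hn, Nat.add_sub_cancel]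
    simp only [← pow_mul, mul_assoc]
  rw [← hQF] at hcQ
  have hsum : ∑ j ∈ Finset.Icc 1 n, -((1 - q) / (1 - q ^ (2 * (j * m)))) =
      (1 - q) * (1 - q ^ m)⁻¹ *
        ∑ k ∈ Finset.range n, -((1 - q ^ m) / (1 - (q ^ m) ^ (2 * (k + 1)))) := by
    rw [Finset.mul_sum, Finset.range_eq_Ico,
      Finset.sum_Ico_add' (fun k => (1 - q) * (1 - q ^ m)⁻¹ *
        -((1 - q ^ m) / (1 - (q ^ m) ^ (2 * k)))) 0 n 1, zero_add]
    refine Finset.sum_congr (by ext; simp) fun j _ => ?_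
    rw [← pow_mul, show m * (2 * j) = 2 * (j * m) by ring]
    field_simp
  rw [hsum, hqm]
  rw [hQ] at hcQ
  rw [div_div_eq_mul_div, div_eq_mul_inv]
  linear_combination (1 - q) * (1 - q ^ m)⁻¹ * hcQ

end RationalFunctions

section GaussLemma

/-- The absolute value of the representative of `j m` modulo `p` of least absolute value. -/
def absRes (p m j : ℕ) : ℕ :=
  if j ∈ Rset p (m : ℤ) then p - res p ((j : ℤ) * m) else res p ((j : ℤ) * m)

theorem res_natCast_mul (p m j : ℕ) : res p ((j : ℤ) * m) = j * m % p := by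
  unfold res
  norm_cast

theorem mem_Rset_iff {p m j n : ℕ} (hn : p = 2 * n + 1) (hj : j ∈ Finset.Icc 1 n) :
    j ∈ Rset p (m : ℤ) ↔ n < j * m % p := by
  have hn' : (p - 1) / 2 = n := by lia
  rw [Rset, Finset.mem_filter, res_natCast_mul, hn']
  simp only [hj, true_and]
  lia

theorem Icc_eq_Ico_half {p n : ℕ} (hn : p = 2 * n + 1) :
    Finset.Icc 1 n = Finset.Ico 1 (p / 2).succ := by
  have : p / 2 = n := by lia
  rw [this]
  ext
  simp

theorem legendreSym_eq_neg_one_pow_card_Rset {p m n : ℕ} [Fact p.Prime] (hn : p = 2 * n + 1)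
    (hm : ¬ p ∣ m) : legendreSym p m = (-1) ^ (Rset p (m : ℤ)).card := by
  have hm0 : ((m : ℤ) : ZMod p) ≠ 0 := by
    rwa [Int.cast_natCast, Ne, ZMod.natCast_eq_zero_iff]
  rw [ZMod.gauss_lemma (by lia) hm0]
  congr 2
  ext j
  rw [← Icc_eq_Ico_half hn, Finset.mem_filter]
  have hval : (((m : ℤ) : ZMod p) * (j : ZMod p)).val = j * m % p := by
    rw [Int.cast_natCast, ← Nat.cast_mul, ZMod.val_natCast, mul_comm]
  rw [hval, show p / 2 = n by lia]
  constructor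
  · exact fun h => (mem_Rset_iff hn h.1).2 h.2
  · intro h
    have hj : j ∈ Finset.Icc 1 n := by
      have := (Finset.mem_filter.1 h).1
      rwa [show (p - 1) / 2 = n by lia] at this
    exact ⟨hj, (mem_Rset_iff hn hj).1 h⟩

theorem map_absRes {p m n : ℕ} [Fact p.Prime] (hn : p = 2 * n + 1) (hm : ¬ p ∣ m) :
    (Finset.Icc 1 n).1.map (absRes p m) = (Finset.Icc 1 n).1 := by
  have hm0 : (m : ZMod p) ≠ 0 := by
    rwa [Ne, ZMod.natCast_eq_zero_iff]
  have h := ZMod.Ico_map_valMinAbs_natAbs_eq_Ico_map_id p (m : ZMod p) hm0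
  rw [← Icc_eq_Ico_half hn, Multiset.map_id'] at h
  conv_rhs => rw [← h]
  refine Multiset.map_congr rfl fun j hj => ?_
  have hval : ((m : ZMod p) * (j : ZMod p)).val = j * m % p := by
    rw [← Nat.cast_mul, ZMod.val_natCast, mul_comm]
  have hlt : j * m % p < p := Nat.mod_lt _ (by lia)
  rw [ZMod.valMinAbs_def_pos, hval, absRes, res_natCast_mul]
  simp only [mem_Rset_iff hn hj, show p / 2 = n by lia]
  split_ifs <;> lia

theorem prod_absRes {M : Type*} [CommMonoid M] {p m n : ℕ} [Fact p.Prime] (hn : p = 2 * n + 1)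
    (hm : ¬ p ∣ m) (f : ℕ → M) :
    ∏ j ∈ Finset.Icc 1 n, f (absRes p m j) = ∏ j ∈ Finset.Icc 1 n, f j := by
  have h : ((Finset.Icc 1 n).1.map fun j => f (absRes p m j)) = (Finset.Icc 1 n).1.map f := by
    conv_rhs => rw [← map_absRes hn hm, Multiset.map_map]
    rfl
  exact congrArg Multiset.prod h

theorem sum_absRes {M : Type*} [AddCommMonoid M] {p m n : ℕ} [Fact p.Prime] (hn : p = 2 * n + 1)
    (hm : ¬ p ∣ m) (f : ℕ → M) :
    ∑ j ∈ Finset.Icc 1 n, f (absRes p m j) = ∑ j ∈ Finset.Icc 1 n, f j :=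
  prod_absRes (M := Multiplicative M) hn hm f

theorem absRes_mem {p m n j : ℕ} [Fact p.Prime] (hn : p = 2 * n + 1) (hm : ¬ p ∣ m)
    (hj : j ∈ Finset.Icc 1 n) : absRes p m j ∈ Finset.Icc 1 n := by
  have h : absRes p m j ∈ (Finset.Icc 1 n).1.map (absRes p m) :=
    Multiset.mem_map.2 ⟨j, hj, rfl⟩
  rw [map_absRes hn hm] at h
  exact h

end GaussLemma

theorem qpoch_q_pow (a n : ℕ) :
    qpoch (q ^ a) (q ^ a) n = ∏ j ∈ Finset.Icc 1 n, (1 - q ^ (a * j)) := by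
  rw [qpoch_self, Finset.range_eq_Ico,
    Finset.prod_Ico_add' (fun j => 1 - (q ^ a) ^ j) 0 n 1, zero_add]
  exact Finset.prod_congr (by ext; simp) fun j _ => by rw [pow_mul]

/-- Sign, power of `q` and quotient of `q`-Pochhammer symbols, grouped index by index. -/
theorem legendreSym_mul_qpoch_eq_prod {p m n : ℕ} [Fact p.Prime] (hn : p = 2 * n + 1)
    (hm : ¬ p ∣ m) :
    (legendreSym p m : RatFunc ℚ) *
        q ^ (2 * ∑ j ∈ Rset p (m : ℤ), (p - res p ((j : ℤ) * m))) *
        (qpoch (q ^ (2 * m)) (q ^ (2 * m)) n / qpoch (q ^ 2) (q ^ 2) n) =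
      ∏ j ∈ Finset.Icc 1 n, (if j ∈ Rset p (m : ℤ) then -q ^ (2 * absRes p m j) else 1) *
        ((1 - q ^ (2 * (j * m))) / (1 - q ^ (2 * absRes p m j))) := by
  have hsub : (Finset.Icc 1 n).filter (· ∈ Rset p (m : ℤ)) = Rset p (m : ℤ) := by
    rw [Finset.filter_mem_eq_inter, Finset.inter_eq_right, Rset, show (p - 1) / 2 = n by lia]
    exact Finset.filter_subset _ _
  have hsum : ∑ j ∈ Rset p (m : ℤ), (p - res p ((j : ℤ) * m)) =
      ∑ j ∈ Rset p (m : ℤ), absRes p m j :=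
    Finset.sum_congr rfl fun j hj => by rw [absRes, if_pos hj]
  rw [Finset.prod_mul_distrib, Finset.prod_div_distrib, ← Finset.prod_filter, hsub,
    Finset.prod_neg, Finset.prod_pow_eq_pow_sum, ← Finset.mul_sum, hsum,
    legendreSym_eq_neg_one_pow_card_Rset hn hm, qpoch_q_pow, qpoch_q_pow,
    prod_absRes hn hm fun j => 1 - q ^ (2 * j)]
  congr 2
  · push_cast
    rfl
  · exact Finset.prod_congr rfl fun j _ => by rw [show 2 * m * j = 2 * (j * m) by ring]

theorem q_euler_quotient_congruence (p : ℕ) [Fact p.Prime] (hp5 : 5 ≤ p)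
    (m : ℕ) (hm : 2 ≤ m) (hpm : ¬ p ∣ m) :
    qCong (pqn Polynomial.X p)
      (((legendreSym p m : RatFunc ℚ) *
          q ^ (2 * ∑ j ∈ Rset p (m : ℤ), (p - res p ((j : ℤ) * m))) *
          (qpoch (q ^ (2 * m)) (q ^ (2 * m)) ((p - 1) / 2) /
            qpoch (q ^ 2) (q ^ 2) ((p - 1) / 2)) - 1) / qn q p)
      (2 * ∑ j ∈ Finset.Icc 1 ((p - 1) / 2),
          ((j * m / p : ℕ) : RatFunc ℚ) * q ^ (2 * j * m) / qn q (2 * j * m) +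
        QF p 2 q - QF p 2 (q ^ m) / qn q m -
        ((Rset p (m : ℤ)).card : RatFunc ℚ) * (1 - q)) := by
  have hp : p.Prime := Fact.out
  obtain ⟨n, hn⟩ : ∃ n, p = 2 * n + 1 := by
    obtain ⟨n, hn⟩ := hp.odd_of_ne_two (by lia)
    exact ⟨n, hn⟩
  have hQ := isQPrime_qn_q hp
  have h2 : ¬ p ∣ 2 := fun h => by
    have := Nat.le_of_dvd two_pos h
    lia
  have hdvd : ∀ j ∈ Finset.Icc 1 n, ¬ p ∣ j := fun j hj h => by
    rw [Finset.mem_Icc] at hj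
    have := Nat.le_of_dvd (by lia) h
    lia
  have happrox := ApproxOne.prod hQ.prime_mem (Finset.Icc 1 n)
    (f := fun j => (if j ∈ Rset p (m : ℤ) then -q ^ (2 * absRes p m j) else 1) *
        ((1 - q ^ (2 * (j * m))) / (1 - q ^ (2 * absRes p m j))))
    (g := fun j => (1 - q) * (2 * ((j * m / p : ℕ) : RatFunc ℚ) * q ^ (2 * (j * m)) /
      (1 - q ^ (2 * (j * m))) - 1 / (1 - q ^ (2 * absRes p m j)) + 1 / (1 - q ^ (2 * (j * m))) -
        if j ∈ Rset p (m : ℤ) then 1 else 0)) (fun j hj => by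
      have hE : ¬ p ∣ 2 * (j * m) := hp.not_dvd_mul h2 (hp.not_dvd_mul (hdvd j hj) hpm)
      have hs : ¬ p ∣ 2 * absRes p m j :=
        hp.not_dvd_mul h2 (hdvd _ (absRes_mem hn hpm hj))
      have hdm := Nat.div_add_mod (j * m) p
      have hlt : j * m % p < p := Nat.mod_lt _ hp.pos
      by_cases hR : j ∈ Rset p (m : ℤ)
      · have ha : absRes p m j = p - j * m % p := by rw [absRes, if_pos hR, res_natCast_mul]
        simp only [if_pos hR]
        exact hQ.approxOne_of_add_eq hE hs (by rw [ha, mul_add_one]; lia)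
      · have ha : absRes p m j = j * m % p := by rw [absRes, if_neg hR, res_natCast_mul]
        simp only [if_neg hR, one_mul, sub_zero]
        exact hQ.approxOne_of_eq_add hE hs (by rw [ha, hdm]))
  rw [← legendreSym_mul_qpoch_eq_prod hn hpm] at happrox
  obtain ⟨c, hc, hcA⟩ := happrox.congrMod hQ.prime_ne_zero
  obtain ⟨d, hd, hdF⟩ := qFermat_two_congrMod hp hp.not_dvd_one hn
  obtain ⟨e, he, heF⟩ := qFermat_two_congrMod hp hpm hn
  have hn' : (p - 1) / 2 = n := by lia
  rw [hn']
  have hcard : ((Rset p (m : ℤ)).card : RatFunc ℚ) =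
      ∑ j ∈ Finset.Icc 1 n, if j ∈ Rset p (m : ℤ) then 1 else 0 := by
    have hsub : (Finset.Icc 1 n).filter (· ∈ Rset p (m : ℤ)) = Rset p (m : ℤ) := by
      rw [Finset.filter_mem_eq_inter, Finset.inter_eq_right, Rset, hn']
      exact Finset.filter_subset _ _
    rw [Finset.sum_boole, hsub]
  have hq1 : 1 - q ≠ 0 := by simpa using one_sub_q_pow_ne_zero one_ne_zero
  have hqn (k : ℕ) : qn q k = (1 - q ^ k) / (1 - q) := by
    rw [← one_sub_mul_qn, mul_div_cancel_left₀ _ hq1]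
  have hfold := sum_absRes hn hpm fun j => -((1 - q) / (1 - q ^ (2 * j)))
  simp only [mul_one, pow_one, show qn q 1 = 1 by simp [qn], div_one] at hdF
  rw [← hfold] at hdF
  have hsum : ∑ j ∈ Finset.Icc 1 n, (1 - q) * (2 * ((j * m / p : ℕ) : RatFunc ℚ) *
      q ^ (2 * (j * m)) / (1 - q ^ (2 * (j * m))) - 1 / (1 - q ^ (2 * absRes p m j)) +
        1 / (1 - q ^ (2 * (j * m))) - if j ∈ Rset p (m : ℤ) then 1 else 0) =
      2 * ∑ j ∈ Finset.Icc 1 n,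
        ((j * m / p : ℕ) : RatFunc ℚ) * q ^ (2 * j * m) / qn q (2 * j * m) +
      ∑ j ∈ Finset.Icc 1 n, -((1 - q) / (1 - q ^ (2 * absRes p m j))) -
      ∑ j ∈ Finset.Icc 1 n, -((1 - q) / (1 - q ^ (2 * (j * m)))) -
      ((Rset p (m : ℤ)).card : RatFunc ℚ) * (1 - q) := by
    rw [hcard, Finset.mul_sum, Finset.sum_mul, ← Finset.sum_add_distrib,
      ← Finset.sum_sub_distrib, ← Finset.sum_sub_distrib]
    refine Finset.sum_congr rfl fun j _ => ?_
    rw [hqn, div_div_eq_mul_div, mul_assoc 2 j m]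
    ring
  refine qCong_of_congrMod ?_ ⟨c - d + e, add_mem (sub_mem hc hd) he, ?_⟩
  · intro h
    apply hQ.prime_ne_zero
    rw [qn_q_eq_algebraMap, h, map_zero]
  · rw [← qn_q_eq_algebraMap]
    linear_combination hcA - hdF + heF + hsum
end

section
/- Let p be an odd prime and m ≥ 1 an integer with p ∤ m. Then (q^m;q^m)_{p−1}/(q;q)_{p−1} ≡ 1 (mod [p]_q); in particular the q-Fermat quotient ((q^m;q^m)_{p−1}/(q;q)_{p−1} − 1)/[p]_q is a rational function whose denominator in lowest terms is coprime to [p]_q. -/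
open Polynomial Finset

/-- The polynomial `(X^m; X^m)_n`. -/
noncomputable def polyPoch (m n : ℕ) : Polynomial ℚ :=
  ∏ i ∈ Finset.range n, (1 - (X ^ m) ^ (i + 1))

theorem algebraMap_polyPoch (m n : ℕ) :
    algebraMap (Polynomial ℚ) (RatFunc ℚ) (polyPoch m n) = qpoch (q ^ m) (q ^ m) n := by
  simp [polyPoch, qpoch, q, map_prod, pow_succ']

theorem algebraMap_pqn_X (n : ℕ) :
    algebraMap (Polynomial ℚ) (RatFunc ℚ) (pqn X n) = qn q n := by
  simp [pqn, qn, q]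

theorem aeval_polyPoch_of_isPrimitiveRoot {n m : ℕ} {μ : ℂ} (hμ : IsPrimitiveRoot μ (n + 1))
    (hm : m.Coprime (n + 1)) : aeval μ (polyPoch m n) = (n + 1 : ℂ) := by
  simpa [polyPoch, map_prod] using (hμ.pow_of_coprime m hm).prod_one_sub_pow_eq_order

theorem pqn_X_eq_cyclotomic {p : ℕ} (hp : p.Prime) : pqn X p = cyclotomic p ℚ := by
  have := Fact.mk hp
  exact (cyclotomic_prime ℚ p).symm

theorem isCoprime_polyPoch_pqn {p m : ℕ} (hp : p.Prime) (hpm : ¬ p ∣ m) :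
    IsCoprime (polyPoch m (p - 1)) (pqn X p) := by
  obtain ⟨n, rfl⟩ := Nat.exists_eq_add_one_of_ne_zero hp.ne_zero
  have hμ := Complex.isPrimitiveRoot_exp (n + 1) n.succ_ne_zero
  rw [pqn_X_eq_cyclotomic hp, isCoprime_comm,
    (cyclotomic.irreducible_rat hp.pos).coprime_iff_not_dvd,
    cyclotomic_eq_minpoly_rat hμ hp.pos]
  intro h
  have h0 := (minpoly.dvd_iff).1 h
  rw [Nat.add_sub_cancel,
    aeval_polyPoch_of_isPrimitiveRoot hμ ((hp.coprime_iff_not_dvd.2 hpm).symm)] at h0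
  exact Nat.cast_add_one_ne_zero n h0

theorem pqn_dvd_polyPoch_sub {p m : ℕ} (hp : p.Prime) (hpm : ¬ p ∣ m) :
    pqn X p ∣ polyPoch m (p - 1) - polyPoch 1 (p - 1) := by
  obtain ⟨n, rfl⟩ := Nat.exists_eq_add_one_of_ne_zero hp.ne_zero
  have hμ := Complex.isPrimitiveRoot_exp (n + 1) n.succ_ne_zero
  rw [pqn_X_eq_cyclotomic hp, cyclotomic_eq_minpoly_rat hμ hp.pos]
  refine minpoly.dvd ℚ _ ?_
  rw [map_sub, Nat.add_sub_cancel,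
    aeval_polyPoch_of_isPrimitiveRoot hμ ((hp.coprime_iff_not_dvd.2 hpm).symm),
    aeval_polyPoch_of_isPrimitiveRoot hμ (Nat.coprime_one_left _), sub_self]

theorem isCoprime_denom_QF {p m : ℕ} (hp : p.Prime) (hpm : ¬ p ∣ m) :
    IsCoprime (QF p m q).denom (pqn X p) := by
  obtain ⟨K, hK⟩ := pqn_dvd_polyPoch_sub hp hpm
  have hcop := isCoprime_polyPoch_pqn hp hp.not_dvd_one
  have hΦ : pqn X p ≠ 0 := pqn_X_eq_cyclotomic hp ▸ cyclotomic_ne_zero p ℚ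
  have hD : polyPoch 1 (p - 1) ≠ 0 := by
    simp only [polyPoch, pow_one, Finset.prod_ne_zero_iff, sub_ne_zero]
    intro i _ h
    simpa using congrArg natDegree h
  have hQF : QF p m q =
      algebraMap _ (RatFunc ℚ) K / algebraMap _ (RatFunc ℚ) (polyPoch 1 (p - 1)) := by
    have hΦ' := RatFunc.algebraMap_ne_zero hΦ
    have hD' := RatFunc.algebraMap_ne_zero hD
    have hK' := congrArg (algebraMap (Polynomial ℚ) (RatFunc ℚ)) hK
    rw [map_sub, map_mul] at hK'
    have h1 : qpoch q q (p - 1) = algebraMap _ (RatFunc ℚ) (polyPoch 1 (p - 1)) := by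
      rw [algebraMap_polyPoch, pow_one]
    rw [QF, ← algebraMap_polyPoch, h1, ← algebraMap_pqn_X]
    field_simp
    linear_combination hK'
  rw [hQF]
  exact hcop.of_isCoprime_of_dvd_left (RatFunc.denom_div_dvd _ _)

theorem q_fermat_quotient_well_defined (p : ℕ) (hp : p.Prime) (hodd : Odd p)
    (m : ℕ) (hm : 1 ≤ m) (hpm : ¬ p ∣ m) :
    qCong (pqn Polynomial.X p)
      (qpoch (q ^ m) (q ^ m) (p - 1) / qpoch q q (p - 1)) 1 ∧
    IsCoprime (QF p m q).denom (pqn Polynomial.X p) := by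
  have h := isCoprime_denom_QF hp hpm
  refine ⟨?_, h⟩
  rwa [qCong, algebraMap_pqn_X]
end
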